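/- Let d ∈ {1, 2, 3} and let q₁, …, q_N be pairwise distinct points in ℝ^d. Define Φ^W(r) = (4r + 1)(1 − r)⁴ for 0 ≤ r ≤ 1 and Φ^W(r) = 0 for r > 1. Then the N × N matrix B with entries B_{ij} = Φ^W(‖q_i − q_j‖) is symmetric and positive definite. -/

import Mathlib

/-- The C² Wendland function: `(4r+1)(1-r)⁴` on `[0,1]`, zero for `r > 1`. -/
noncomputable def wendlandC2 (r : ℝ) : ℝ :=
  if r ≤ 1 then (4 * r + 1) * (1 - r) ^ 4 else 0

section

open MeasureTheory Set Filter Topology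

/-- Positivity of solutions of `F''' + F' = H` with zero initial data on `(0, 6]`. -/
lemma ode_pos (F F1 F2 F3 : ℝ → ℝ) (h0 : F 0 = 0) (h1 : F1 0 = 0) (h2 : F2 0 = 0)
    (d0 : ∀ s, HasDerivAt F (F1 s) s) (d1 : ∀ s, HasDerivAt F1 (F2 s) s)
    (d2 : ∀ s, HasDerivAt F2 (F3 s) s) (t : ℝ) (ht : 0 < t) (ht6 : t ≤ 6)
    (H : ∀ s, 0 < s → s < t → 0 < F3 s + F1 s) : 0 < F t := by
  have hd : ∀ s, HasDerivAt (fun s => F2 s * (1 - Real.cos (t - s)) + F1 s * Real.sin (t - s)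
      + F s * Real.cos (t - s) + F s * (1 - Real.cos (t - s)))
      ((F3 s + F1 s) * (1 - Real.cos (t - s))) s := by
    intro s
    have e : HasDerivAt (fun s => t - s) (-1) s := by
      simpa using (hasDerivAt_id s).const_sub t
    have hc := e.cos
    have hs := e.sin
    have := ((((d2 s).mul (hc.const_sub 1)).add ((d1 s).mul hs)).add ((d0 s).mul hc)).add
      ((d0 s).mul (hc.const_sub 1))
    convert! this using 1
    ring
  have hm : StrictMonoOn (fun s => F2 s * (1 - Real.cos (t - s)) + F1 s * Real.sin (t - s)
      + F s * Real.cos (t - s) + F s * (1 - Real.cos (t - s))) (Icc 0 t) := by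
    apply strictMonoOn_of_deriv_pos (convex_Icc 0 t)
    · exact fun s _ => (hd s).continuousAt.continuousWithinAt
    · intro s hs
      rw [interior_Icc] at hs
      rw [(hd s).deriv]
      apply mul_pos (H s hs.1 hs.2)
      have h1 : Real.cos (t - s) ≠ 1 := by
        intro h
        have := (Real.cos_eq_one_iff_of_lt_of_lt (x := t - s) (by linarith [Real.pi_pos, hs.2])
          (by linarith [Real.pi_gt_three, hs.1])).1 h
        linarith [hs.2]
      have := lt_of_le_of_ne (Real.cos_le_one (t - s)) h1
      linarith
  have := hm (left_mem_Icc.2 ht.le) (right_mem_Icc.2 ht.le) ht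
  simpa [h0, h1, h2] using this

lemma wQ_pos (t : ℝ) (ht : 0 < t) : 0 < 2 * t - 3 * Real.sin t + t * Real.cos t := by
  rcases le_or_gt t 6 with h6 | h6
  · refine ode_pos (fun t => 2 * t - 3 * Real.sin t + t * Real.cos t)
      (fun t => 2 - 2 * Real.cos t - t * Real.sin t) (fun t => Real.sin t - t * Real.cos t)
      (fun t => t * Real.sin t) (by simp) (by simp) (by simp) ?_ ?_ ?_ t ht h6 ?_
    · intro s
      have := (((hasDerivAt_id s).const_mul 2).sub ((Real.hasDerivAt_sin s).const_mul 3)).add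
        ((hasDerivAt_id s).mul (Real.hasDerivAt_cos s))
      convert! this using 1
      simp; ring
    · intro s
      have := (((Real.hasDerivAt_cos s).const_mul 2).const_sub 2).sub
        ((hasDerivAt_id s).mul (Real.hasDerivAt_sin s))
      convert! this using 1
      simp; ring
    · intro s
      have := (Real.hasDerivAt_sin s).sub
        ((hasDerivAt_id s).mul (Real.hasDerivAt_cos s))
      convert! this using 1
      simp
    · intro s hs hst
      have h1 : Real.cos s ≠ 1 := by
        intro h
        have := (Real.cos_eq_one_iff_of_lt_of_lt (x := s) (by linarith [Real.pi_pos])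
          (by linarith [Real.pi_gt_three])).1 h
        linarith
      have := lt_of_le_of_ne (Real.cos_le_one s) h1
      linarith
  · nlinarith [Real.sin_le_one t, Real.neg_one_le_cos t]

lemma wP_pos (t : ℝ) (ht : 0 < t) :
    0 < 4 * t ^ 2 + 9 * t * Real.sin t - t ^ 2 * Real.cos t - 24 + 24 * Real.cos t := by
  rcases le_or_gt t 6 with h6 | h6
  · refine ode_pos
      (fun t => 4 * t ^ 2 + 9 * t * Real.sin t - t ^ 2 * Real.cos t - 24 + 24 * Real.cos t)
      (fun t => 8 * t - 15 * Real.sin t + 7 * t * Real.cos t + t ^ 2 * Real.sin t)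
      (fun t => 8 - 8 * Real.cos t - 5 * t * Real.sin t + t ^ 2 * Real.cos t)
      (fun t => 3 * Real.sin t - 3 * t * Real.cos t - t ^ 2 * Real.sin t)
      (by simp) (by simp) (by simp) ?_ ?_ ?_ t ht h6 ?_
    · intro s
      have := ((((((hasDerivAt_id s).pow 2).const_mul 4).add (((hasDerivAt_id s).const_mul 9).mul
        (Real.hasDerivAt_sin s))).sub (((hasDerivAt_id s).pow 2).mul
          (Real.hasDerivAt_cos s))).sub_const 24).add ((Real.hasDerivAt_cos s).const_mul 24)
      convert! this using 1
      simp; ring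
    · intro s
      have := ((((hasDerivAt_id s).const_mul 8).sub ((Real.hasDerivAt_sin s).const_mul 15)).add
        (((hasDerivAt_id s).const_mul 7).mul (Real.hasDerivAt_cos s))).add
        (((hasDerivAt_id s).pow 2).mul (Real.hasDerivAt_sin s))
      convert! this using 1
      simp; ring
    · intro s
      have := ((((Real.hasDerivAt_cos s).const_mul 8).const_sub 8).sub
        (((hasDerivAt_id s).const_mul 5).mul (Real.hasDerivAt_sin s))).add
        (((hasDerivAt_id s).pow 2).mul (Real.hasDerivAt_cos s))
      convert! this using 1
      simp; ring
    · intro s hs hst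
      have := wQ_pos s hs
      linarith
  · nlinarith [Real.neg_one_le_sin t, Real.cos_le_one t, Real.neg_one_le_cos t,
      mul_nonneg (sq_nonneg t) (sub_nonneg.2 (Real.cos_le_one t)),
      mul_nonneg ht.le (neg_le_iff_add_nonneg.1 (Real.neg_one_le_sin t))]

/-- One-dimensional Fourier transform of the Wendland function. -/
noncomputable def wW (k : ℝ) : ℝ := 240 * (k ^ 2 + k * Real.sin k - 4 + 4 * Real.cos k) / k ^ 6

/-- Radial profile of the three-dimensional transform: `-W'(s) / s`. -/
noncomputable def wv (s : ℝ) : ℝ :=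
  240 * (4 * s ^ 2 + 9 * s * Real.sin s - s ^ 2 * Real.cos s - 24 + 24 * Real.cos s) / s ^ 8

lemma wv_pos (s : ℝ) (hs : 0 < s) : 0 < wv s := by
  have := wP_pos s hs
  unfold wv; positivity

lemma wW_deriv (s : ℝ) (hs : s ≠ 0) : HasDerivAt wW (-(s * wv s)) s := by
  have h1 := (((((hasDerivAt_id s).pow 2).add ((hasDerivAt_id s).mul
        (Real.hasDerivAt_sin s))).sub_const 4).add
        ((Real.hasDerivAt_cos s).const_mul 4)).const_mul 240
  have := h1.div ((hasDerivAt_id s).pow 6) (by simpa using hs)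
  convert! this using 1
  simp [wv]
  field_simp
  ring

lemma wW_abs (k : ℝ) : wW |k| = wW k := by
  rcases abs_choice k with h | h <;> rw [h]
  simp [wW, Even.neg_pow (by decide : Even 6)]

lemma wW_bound (k : ℝ) (hk : 1 ≤ |k|) : |wW k| ≤ 2400 / k ^ 2 := by
  rw [← wW_abs k, ← sq_abs k]
  generalize |k| = t at hk
  have ht : 0 < t := by linarith
  unfold wW
  rw [abs_div, abs_of_pos (by positivity : 0 < t ^ 6), div_le_div_iff₀ (by positivity) (by positivity)]
  have h1 : |240 * (t ^ 2 + t * Real.sin t - 4 + 4 * Real.cos t)| ≤ 2400 * t ^ 2 := by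
    rw [abs_le]
    constructor <;> nlinarith [Real.neg_one_le_sin t, Real.sin_le_one t, Real.cos_le_one t,
      Real.neg_one_le_cos t]
  have h2 : t ^ 2 * t ^ 2 ≤ t ^ 6 := by
    have := pow_le_pow_right₀ hk (show 4 ≤ 6 by norm_num)
    nlinarith
  nlinarith [sq_nonneg t]

lemma wW_tendsto : Tendsto wW atTop (𝓝 0) := by
  have h : Tendsto (fun k : ℝ => 2400 / k ^ 2) atTop (𝓝 0) :=
    tendsto_const_nhds.div_atTop (tendsto_pow_atTop (by norm_num))
  refine squeeze_zero_norm' ?_ h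
  filter_upwards [eventually_ge_atTop 1] with k hk
  exact wW_bound k (by rwa [abs_of_nonneg (by linarith)])

lemma wv_measurable : Measurable wv := by
  unfold wv; fun_prop

lemma wW_measurable : Measurable wW := by
  unfold wW; fun_prop

lemma half_int (c : ℂ) (hc : c ≠ 0) :
    ∫ x in (0 : ℝ)..1, ((4 * x + 1) * (1 - x) ^ 4 : ℂ) * Complex.exp (c * x)
      = Complex.exp c * (120 / c ^ 5 - 480 / c ^ 6)
        - (1 / c - 20 / c ^ 3 - 120 / c ^ 4 - 360 / c ^ 5 - 480 / c ^ 6) := by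
  have key : ∀ x : ℂ, HasDerivAt (fun x : ℂ => ((4 * x ^ 5 - 15 * x ^ 4 + 20 * x ^ 3 - 10 * x ^ 2 + 1) / c
      - (20 * x ^ 4 - 60 * x ^ 3 + 60 * x ^ 2 - 20 * x) / c ^ 2
      + (80 * x ^ 3 - 180 * x ^ 2 + 120 * x - 20) / c ^ 3
      - (240 * x ^ 2 - 360 * x + 120) / c ^ 4 + (480 * x - 360) / c ^ 5 - 480 / c ^ 6)
      * Complex.exp (c * x)) (((4 * x + 1) * (1 - x) ^ 4 : ℂ) * Complex.exp (c * x)) x := by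
    intro x
    have hi := hasDerivAt_id x
    have h5 := hasDerivAt_pow 5 x
    have h4 := hasDerivAt_pow 4 x
    have h3 := hasDerivAt_pow 3 x
    have h2 := hasDerivAt_pow 2 x
    have he : HasDerivAt (fun x : ℂ => Complex.exp (c * x)) (Complex.exp (c * x) * c) x := by
      simpa using ((hasDerivAt_id x).const_mul c).cexp
    have p0 := (((((h5.const_mul 4).sub (h4.const_mul 15)).add (h3.const_mul 20)).sub
      (h2.const_mul 10)).add_const 1).div_const c
    have p1 := ((((h4.const_mul 20).sub (h3.const_mul 60)).add (h2.const_mul 60)).sub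
      (hi.const_mul 20)).div_const (c ^ 2)
    have p2 := ((((h3.const_mul 80).sub (h2.const_mul 180)).add (hi.const_mul 120)).sub_const
      20).div_const (c ^ 3)
    have p3 := (((h2.const_mul 240).sub (hi.const_mul 360)).add_const 120).div_const (c ^ 4)
    have p4 := ((hi.const_mul 480).sub_const 360).div_const (c ^ 5)
    have := (((((p0.sub p1).add p2).sub p3).add p4).sub_const (480 / c ^ 6)).mul he
    convert! this using 1
    simp only [Pi.sub_apply, Pi.add_apply, id]
    field_simp
    push_cast
    ring
  have := intervalIntegral.integral_eq_sub_of_hasDerivAt (a := 0) (b := 1)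
    (fun x _ => (key (x : ℂ)).comp_ofReal) (Continuous.intervalIntegrable (by fun_prop) _ _)
  rw [this]
  push_cast
  simp only [mul_one, mul_zero, Complex.exp_zero]
  field_simp
  ring

lemma wend_cont : Continuous (fun x : ℝ => wendlandC2 |x|) := by
  unfold wendlandC2
  apply Continuous.if_le <;> try fun_prop
  intro x hx
  rw [hx]; ring

lemma wend_supp (x : ℝ) (hx : 1 ≤ |x|) : wendlandC2 |x| = 0 := by
  unfold wendlandC2
  split_ifs with h
  · rw [le_antisymm h hx]; ring
  · rfl

lemma wend_integrable : Integrable (fun x : ℝ => (wendlandC2 |x| : ℂ)) := by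
  apply Continuous.integrable_of_hasCompactSupport
  · exact Complex.continuous_ofReal.comp wend_cont
  · apply HasCompactSupport.intro (isCompact_Icc (a := (-1 : ℝ)) (b := 1))
    intro x hx
    rw [wend_supp x, Complex.ofReal_zero]
    by_contra h
    push Not at h
    exact hx (abs_le.1 h.le)

lemma wend_ft (k : ℝ) (hk : k ≠ 0) :
    ∫ x : ℝ, Complex.exp (-(k * Complex.I) * x) * (wendlandC2 |x| : ℂ) = (wW k : ℂ) := by
  set c : ℂ := -(k * Complex.I) with hcdef
  have hc : c ≠ 0 := by simp [hcdef, hk]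
  have hcont : Continuous (fun x : ℝ => Complex.exp (c * x) * (wendlandC2 |x| : ℂ)) := by
    have := Complex.continuous_ofReal.comp wend_cont
    exact Continuous.mul (by fun_prop) this
  have hs : Function.support (fun x : ℝ => Complex.exp (c * x) * (wendlandC2 |x| : ℂ)) ⊆ Ioc (-1) 1 := by
    intro x hx
    by_contra h
    apply hx
    simp only
    rw [wend_supp x, Complex.ofReal_zero, mul_zero]
    by_contra h'
    push Not at h'
    exact h ⟨(abs_lt.1 h').1, (abs_lt.1 h').2.le⟩
  rw [← intervalIntegral.integral_eq_integral_of_support_subset hs,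
    ← intervalIntegral.integral_add_adjacent_intervals (b := 0) (hcont.intervalIntegrable _ _)
      (hcont.intervalIntegrable _ _)]
  have h1 : ∫ x in (0 : ℝ)..1, Complex.exp (c * x) * (wendlandC2 |x| : ℂ)
      = ∫ x in (0 : ℝ)..1, ((4 * x + 1) * (1 - x) ^ 4 : ℂ) * Complex.exp (c * x) := by
    apply intervalIntegral.integral_congr
    intro x hx
    rw [uIcc_of_le zero_le_one] at hx
    simp only
    rw [abs_of_nonneg hx.1, wendlandC2, if_pos hx.2]
    push_cast; ring
  have h2 : ∫ x in (-1 : ℝ)..0, Complex.exp (c * x) * (wendlandC2 |x| : ℂ)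
      = ∫ x in (0 : ℝ)..1, ((4 * x + 1) * (1 - x) ^ 4 : ℂ) * Complex.exp (-c * x) := by
    have := intervalIntegral.integral_comp_neg (a := 0) (b := 1)
      (fun x : ℝ => Complex.exp (c * x) * (wendlandC2 |x| : ℂ))
    rw [neg_zero] at this
    rw [← this]
    apply intervalIntegral.integral_congr
    intro x hx
    rw [uIcc_of_le zero_le_one] at hx
    simp only
    rw [abs_neg, abs_of_nonneg hx.1, wendlandC2, if_pos hx.2]
    push_cast; ring_nf
  rw [h1, h2, half_int c hc, half_int (-c) (neg_ne_zero.2 hc)]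
  have e1 : Complex.exp c = Complex.cos k - Complex.sin k * Complex.I := by
    rw [hcdef, ← neg_mul, Complex.exp_mul_I, Complex.cos_neg, Complex.sin_neg]; ring
  have e2 : Complex.exp (-c) = Complex.cos k + Complex.sin k * Complex.I := by
    rw [hcdef, neg_neg, Complex.exp_mul_I]
  rw [e1, e2]
  have hk' : (k : ℂ) ≠ 0 := by exact_mod_cast hk
  have I2 := Complex.I_sq
  have c2 : c ^ 2 = - (k : ℂ) ^ 2 := by rw [hcdef, neg_sq, mul_pow, I2]; ring
  have c4 : c ^ 4 = (k : ℂ) ^ 4 := by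
    rw [show c ^ 4 = (c ^ 2) ^ 2 by ring, c2]; ring
  have c6 : c ^ 6 = - (k : ℂ) ^ 6 := by
    rw [show c ^ 6 = (c ^ 2) ^ 3 by ring, c2]; ring
  have c5 : 1 / c ^ 5 = Complex.I / (k : ℂ) ^ 5 := by
    have : c ^ 5 = - (k : ℂ) ^ 5 * Complex.I := by
      rw [show c ^ 5 = c ^ 4 * c by ring, c4, hcdef]; ring
    rw [this]
    have := Complex.I_ne_zero
    field_simp
    rw [I2]
  have n4 : (-c) ^ 4 = c ^ 4 := by ring
  have n5 : (-c) ^ 5 = - c ^ 5 := by ring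
  have n3 : (-c) ^ 3 = - c ^ 3 := by ring
  have n6 : (-c) ^ 6 = c ^ 6 := by ring
  rw [n3, n4, n5, n6, wW]
  push_cast
  trans (-2 * Complex.sin k * Complex.I) * 120 * (1 / c ^ 5) - 960 * Complex.cos k / c ^ 6
    + 240 / c ^ 4 + 960 / c ^ 6
  · ring
  · rw [c5, c6, c4]
    field_simp
    linear_combination (-240 * Complex.sin k * k) * I2

lemma wW_integrable : Integrable wW := by
  have hC := wend_integrable.norm
  set C := ∫ x : ℝ, ‖(wendlandC2 |x| : ℂ)‖ with hCd
  have hC0 : 0 ≤ C := integral_nonneg fun _ => norm_nonneg _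
  refine Integrable.mono' (integrable_inv_one_add_sq.const_mul (2 * C + 4800))
    wW_measurable.aestronglyMeasurable ?_
  have : ∀ᵐ k : ℝ, k ≠ 0 := by simp [ae_iff]
  filter_upwards [this] with k hk
  rw [Real.norm_eq_abs, ← div_eq_mul_inv, le_div_iff₀ (by positivity)]
  rcases le_or_gt 1 |k| with h | h
  · have h1 := wW_bound k h
    have h2 : 1 ≤ k ^ 2 := by rw [← sq_abs]; nlinarith
    rw [le_div_iff₀ (by positivity)] at h1
    nlinarith [abs_nonneg (wW k)]
  · have h1 : |wW k| ≤ C := by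
      rw [← Real.norm_eq_abs, ← Complex.norm_real, ← wend_ft k hk]
      refine (norm_integral_le_integral_norm _).trans (le_of_eq ?_)
      rw [hCd]
      congr 1
      ext x
      rw [norm_mul, show -(k * Complex.I) * (x : ℂ) = ((-k * x : ℝ) : ℂ) * Complex.I by
        push_cast; ring, Complex.norm_exp_ofReal_mul_I, one_mul]
    have h2 : k ^ 2 ≤ 1 := by rw [← sq_abs]; nlinarith [abs_nonneg k]
    nlinarith [abs_nonneg (wW k)]

open FourierTransform in
lemma wW_inv (x : ℝ) :
    ∫ k : ℝ, (wW k : ℂ) * Complex.exp (((k * x : ℝ) : ℂ) * Complex.I)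
      = 2 * Real.pi * (wendlandC2 |x| : ℂ) := by
  have hpi := Real.pi_pos
  have hF : ∀ w : ℝ, w ≠ 0 → 𝓕 (fun x : ℝ => (wendlandC2 |x| : ℂ)) w = (wW (2 * Real.pi * w) : ℂ) := by
    intro w hw
    rw [Real.fourier_real_eq_integral_exp_smul, ← wend_ft _ (by positivity)]
    congr 1
    ext v
    rw [smul_eq_mul]
    congr 2
    push_cast; ring
  have hae : ∀ᵐ k : ℝ, k ≠ 0 := by simp [ae_iff]
  have hFae : (𝓕 (fun x : ℝ => (wendlandC2 |x| : ℂ))) =ᵐ[volume]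
      fun w => (wW (2 * Real.pi * w) : ℂ) := by
    filter_upwards [hae] with w hw using hF w hw
  have hInteg : Integrable (𝓕 (fun x : ℝ => (wendlandC2 |x| : ℂ))) :=
    (integrable_congr hFae).2 (wW_integrable.comp_mul_left' (by positivity)).ofReal
  have hinv := Continuous.fourierInv_fourier_eq (f := fun x : ℝ => (wendlandC2 |x| : ℂ))
    (Complex.continuous_ofReal.comp wend_cont) wend_integrable hInteg
  have hx := congrFun hinv x
  rw [← hx, Real.fourierInv_eq']
  have := Measure.integral_comp_mul_left
    (fun k : ℝ => (wW k : ℂ) * Complex.exp (((k * x : ℝ) : ℂ) * Complex.I)) (2 * Real.pi)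
  have h3 : ∫ w : ℝ, Complex.exp (((2 * Real.pi * inner ℝ w x : ℝ) : ℂ) * Complex.I) •
      𝓕 (fun x : ℝ => (wendlandC2 |x| : ℂ)) w
      = ∫ w : ℝ, (wW (2 * Real.pi * w) : ℂ) *
        Complex.exp (((2 * Real.pi * w * x : ℝ) : ℂ) * Complex.I) := by
    apply integral_congr_ae
    filter_upwards [hFae] with w hw
    rw [hw, smul_eq_mul, mul_comm]
    congr 4
    simp
    ring
  rw [h3, this, abs_of_pos (by positivity), Complex.real_smul]
  generalize (∫ k : ℝ, (wW k : ℂ) * Complex.exp (((k * x : ℝ) : ℂ) * Complex.I)) = Y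
  push_cast
  field_simp

lemma slice_aux (z : ℝ) (hz : z ≠ 0) :
    IntegrableOn (fun y : ℝ => y * wv (Real.sqrt (z ^ 2 + y ^ 2))) (Ioi 0) ∧
    ∫ y in Ioi (0 : ℝ), y * wv (Real.sqrt (z ^ 2 + y ^ 2)) = wW z := by
  have hz2 : 0 < z ^ 2 := by positivity
  have hd : ∀ y : ℝ, HasDerivAt (fun y : ℝ => -wW (Real.sqrt (z ^ 2 + y ^ 2)))
      (y * wv (Real.sqrt (z ^ 2 + y ^ 2))) y := by
    intro y
    have hp : 0 < z ^ 2 + y ^ 2 := by positivity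
    have hs : 0 < Real.sqrt (z ^ 2 + y ^ 2) := Real.sqrt_pos.2 hp
    have h1 : HasDerivAt (fun y : ℝ => z ^ 2 + y ^ 2) (2 * y) y := by
      simpa using (hasDerivAt_pow 2 y).const_add (z ^ 2)
    have h2 := h1.sqrt hp.ne'
    have h3 := ((wW_deriv _ hs.ne').comp y h2).neg
    convert! h3 using 1
    field_simp
  have hnn : ∀ y ∈ Ioi (0 : ℝ), 0 ≤ y * wv (Real.sqrt (z ^ 2 + y ^ 2)) := by
    intro y hy
    exact mul_nonneg (le_of_lt hy) (wv_pos _ (Real.sqrt_pos.2 (by positivity))).le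
  have hl : Tendsto (fun y : ℝ => -wW (Real.sqrt (z ^ 2 + y ^ 2))) atTop (𝓝 0) := by
    rw [← neg_zero]
    apply Tendsto.neg
    apply wW_tendsto.comp
    apply Real.tendsto_sqrt_atTop.comp
    exact tendsto_atTop_add_const_left _ _ (tendsto_pow_atTop (by norm_num))
  refine ⟨integrableOn_Ioi_deriv_of_nonneg' (fun y _ => hd y) hnn hl, ?_⟩
  rw [integral_Ioi_of_hasDerivAt_of_nonneg' (fun y _ => hd y) hnn hl]
  simp [Real.sqrt_sq_eq_abs, wW_abs]

lemma slice (z : ℝ) (hz : z ≠ 0) :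
    Integrable (fun p : ℂ => wv (Real.sqrt (z ^ 2 + ‖p‖ ^ 2))) ∧
    ∫ p : ℂ, wv (Real.sqrt (z ^ 2 + ‖p‖ ^ 2)) = 2 * Real.pi * wW z := by
  obtain ⟨h1, h2⟩ := slice_aux z hz
  constructor
  · refine (integrable_fun_norm_addHaar (E := ℂ) volume
      (f := fun y => wv (Real.sqrt (z ^ 2 + y ^ 2)))).2 ?_
    simpa [Complex.finrank_real_complex] using h1
  · have := integral_fun_norm_addHaar (E := ℂ) volume (fun y => wv (Real.sqrt (z ^ 2 + y ^ 2)))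
    rw [this, Complex.finrank_real_complex]
    simp only [Nat.add_one_sub_one, pow_one, smul_eq_mul, h2, Measure.real, Complex.volume_ball]
    simp
    ring

/-- Three-dimensional frequency space. -/
abbrev E3 := WithLp 2 (ℝ × ℂ)

lemma E3_norm (p : ℝ × ℂ) : ‖(WithLp.toLp 2 p : E3)‖ = Real.sqrt (p.1 ^ 2 + ‖p.2‖ ^ 2) := by
  rw [WithLp.prod_norm_eq_of_L2]; simp

lemma prod_int : Integrable (fun p : ℝ × ℂ => wv (Real.sqrt (p.1 ^ 2 + ‖p.2‖ ^ 2))) := by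
  have hae : ∀ᵐ k : ℝ, k ≠ 0 := by simp [ae_iff]
  have hm : Measurable (fun p : ℝ × ℂ => wv (Real.sqrt (p.1 ^ 2 + ‖p.2‖ ^ 2))) :=
    wv_measurable.comp (by fun_prop)
  rw [Measure.volume_eq_prod, integrable_prod_iff hm.aestronglyMeasurable]
  constructor
  · filter_upwards [hae] with z hz using (slice z hz).1
  · refine (wW_integrable.const_mul (2 * Real.pi)).congr ?_
    filter_upwards [hae] with z hz
    rw [← (slice z hz).2]
    congr 1
    ext p
    rw [Real.norm_of_nonneg (wv_pos _ (Real.sqrt_pos.2 (by positivity))).le]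

lemma E3_int : Integrable (fun ξ : E3 => wv ‖ξ‖) := by
  rw [← (WithLp.volume_preserving_toLp (U := ℝ) (V := ℂ)).integrable_comp_emb
    (MeasurableEquiv.toLp 2 (ℝ × ℂ)).measurableEmbedding]
  refine prod_int.congr (Eventually.of_forall fun p => ?_)
  simp only [Function.comp, E3_norm]

lemma E3_axis (r : ℝ) :
    ∫ ξ : E3, (wv ‖ξ‖ : ℂ) *
      Complex.exp (((inner ℝ (WithLp.toLp 2 (r, (0 : ℂ)) : E3) ξ : ℝ) : ℂ) * Complex.I)
      = 4 * Real.pi ^ 2 * (wendlandC2 |r| : ℂ) := by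
  have hae : ∀ᵐ k : ℝ, k ≠ 0 := by simp [ae_iff]
  rw [← (WithLp.volume_preserving_toLp (U := ℝ) (V := ℂ)).integral_comp
    (MeasurableEquiv.toLp 2 (ℝ × ℂ)).measurableEmbedding]
  simp only [E3_norm, WithLp.prod_inner_apply, inner_zero_left, add_zero]
  rw [Measure.volume_eq_prod, integral_prod]
  · have : ∀ᵐ z : ℝ, (∫ p : ℂ, (wv (Real.sqrt (z ^ 2 + ‖p‖ ^ 2)) : ℂ) *
        Complex.exp (((inner ℝ r z : ℝ) : ℂ) * Complex.I))
        = 2 * Real.pi * ((wW z : ℂ) * Complex.exp (((z * r : ℝ) : ℂ) * Complex.I)) := by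
      filter_upwards [hae] with z hz
      rw [integral_mul_const, integral_complex_ofReal, (slice z hz).2]
      push_cast
      simp
      ring
    rw [integral_congr_ae this, integral_const_mul, wW_inv]
    ring
  · rw [← Measure.volume_eq_prod]
    refine prod_int.ofReal.mul_bdd (c := 1) (Measurable.aestronglyMeasurable (by fun_prop)) ?_
    exact Eventually.of_forall fun p => by rw [Complex.norm_exp_ofReal_mul_I]

lemma E3_ft (x : E3) :
    ∫ ξ : E3, (wv ‖ξ‖ : ℂ) * Complex.exp (((inner ℝ x ξ : ℝ) : ℂ) * Complex.I)
      = 4 * Real.pi ^ 2 * (wendlandC2 ‖x‖ : ℂ) := by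
  have h := E3_axis ‖x‖
  rw [abs_norm] at h
  rw [← h]
  set e : E3 := WithLp.toLp 2 (‖x‖, (0 : ℂ)) with he
  have hn : ‖x‖ = ‖e‖ := by
    have := E3_norm (‖x‖, 0)
    rw [he, this, norm_zero, zero_pow two_ne_zero, add_zero, Real.sqrt_sq (norm_nonneg x)]
  let L := (Submodule.span ℝ {x - e})ᗮ.reflection
  have hL : L x = e := Submodule.reflection_sub hn
  have := (L.measurePreserving).integral_comp L.toMeasurableEquiv.measurableEmbedding
    (fun ξ : E3 => (wv ‖ξ‖ : ℂ) * Complex.exp (((inner ℝ e ξ : ℝ) : ℂ) * Complex.I))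
  rw [← this]
  congr 1
  ext ξ
  rw [← hL, L.norm_map, L.inner_map_map]

lemma exp_indep {N : ℕ} (q : Fin N → E3) (hq : Function.Injective q) (c : Fin N → ℝ)
    (h : ∀ ξ : E3, ∑ i, (c i : ℂ) * Complex.exp (((inner ℝ (q i) ξ : ℝ) : ℂ) * Complex.I) = 0) :
    c = 0 := by
  let χ : Fin N → (Multiplicative E3 →* ℂ) := fun i =>
    { toFun := fun ξ => Complex.exp (((inner ℝ (q i) ξ.toAdd : ℝ) : ℂ) * Complex.I)
      map_one' := by simp
      map_mul' := by
        intro a b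
        rw [← Complex.exp_add, toAdd_mul, inner_add_right]
        push_cast
        congr 1
        ring }
  have hχ : Function.Injective χ := by
    intro i j hij
    by_contra hne
    have hu : q i - q j ≠ 0 := sub_ne_zero.2 fun h => hne (hq h)
    have hu' : ‖q i - q j‖ ^ 2 ≠ 0 := by simpa using hu
    have h1 : Complex.exp (((inner ℝ (q i) ((Real.pi / ‖q i - q j‖ ^ 2) • (q i - q j)) : ℝ) : ℂ)
        * Complex.I) =
        Complex.exp (((inner ℝ (q j) ((Real.pi / ‖q i - q j‖ ^ 2) • (q i - q j)) : ℝ) : ℂ)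
        * Complex.I) :=
      DFunLike.congr_fun hij (Multiplicative.ofAdd ((Real.pi / ‖q i - q j‖ ^ 2) • (q i - q j)))
    have h2 : (inner ℝ (q i) ((Real.pi / ‖q i - q j‖ ^ 2) • (q i - q j)) : ℝ)
        = Real.pi + inner ℝ (q j) ((Real.pi / ‖q i - q j‖ ^ 2) • (q i - q j)) := by
      rw [← sub_eq_iff_eq_add, ← inner_sub_left, inner_smul_right, real_inner_self_eq_norm_sq]
      field_simp
    rw [h2, Complex.ofReal_add, add_mul, Complex.exp_add, Complex.exp_pi_mul_I] at h1
    have h3 := Complex.exp_ne_zero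
      (((inner ℝ (q j) ((Real.pi / ‖q i - q j‖ ^ 2) • (q i - q j)) : ℝ) : ℂ) * Complex.I)
    apply h3
    linear_combination (-1 / 2 : ℂ) * h1
  have hli := (linearIndependent_monoidHom (Multiplicative E3) ℂ).comp χ hχ
  rw [Fintype.linearIndependent_iff] at hli
  have := hli (fun i => (c i : ℂ)) (by
    ext ξ
    simpa [χ] using h ξ.toAdd)
  ext i
  exact_mod_cast this i

lemma quad_pos {N : ℕ} (q : Fin N → E3) (hq : Function.Injective q) (c : Fin N → ℝ)
    (hc : c ≠ 0) : 0 < ∑ i, ∑ j, c i * c j * wendlandC2 ‖q i - q j‖ := by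
  set S : E3 → ℂ := fun ξ =>
    ∑ i, (c i : ℂ) * Complex.exp (((inner ℝ (q i) ξ : ℝ) : ℂ) * Complex.I) with hS
  have hterm : ∀ x : E3, Integrable (fun ξ : E3 => (wv ‖ξ‖ : ℂ) *
      Complex.exp (((inner ℝ x ξ : ℝ) : ℂ) * Complex.I)) := by
    intro x
    refine E3_int.ofReal.mul_bdd (c := 1) (Continuous.aestronglyMeasurable (by fun_prop)) ?_
    exact Eventually.of_forall fun p => by rw [Complex.norm_exp_ofReal_mul_I]
  have hexp : ∀ ξ : E3, ((wv ‖ξ‖ * Complex.normSq (S ξ) : ℝ) : ℂ) =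
      ∑ i, ∑ j, ((c i : ℂ) * c j) * ((wv ‖ξ‖ : ℂ) *
        Complex.exp (((inner ℝ (q i - q j) ξ : ℝ) : ℂ) * Complex.I)) := by
    intro ξ
    rw [Complex.ofReal_mul, Complex.normSq_eq_conj_mul_self, mul_comm (starRingEnd ℂ _), hS]
    simp only
    rw [map_sum, Finset.sum_mul_sum, Finset.mul_sum]
    refine Finset.sum_congr rfl fun i _ => ?_
    rw [Finset.mul_sum]
    refine Finset.sum_congr rfl fun j _ => ?_
    rw [map_mul, Complex.conj_ofReal, ← Complex.exp_conj, map_mul, Complex.conj_ofReal,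
      Complex.conj_I, inner_sub_left, Complex.ofReal_sub, sub_mul, sub_eq_add_neg,
      Complex.exp_add, mul_neg]
    ring
  have hIntegC : Integrable (fun ξ : E3 => ((wv ‖ξ‖ * Complex.normSq (S ξ) : ℝ) : ℂ)) := by
    simp_rw [hexp]
    exact integrable_finsetSum _ fun i _ => integrable_finsetSum _ fun j _ =>
      (hterm _).const_mul _
  have hInteg : Integrable (fun ξ : E3 => wv ‖ξ‖ * Complex.normSq (S ξ)) := by
    simpa using hIntegC.re
  have hval : ∫ ξ : E3, wv ‖ξ‖ * Complex.normSq (S ξ)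
      = 4 * Real.pi ^ 2 * ∑ i, ∑ j, c i * c j * wendlandC2 ‖q i - q j‖ := by
    apply Complex.ofReal_injective
    rw [← integral_complex_ofReal]
    simp_rw [hexp]
    rw [integral_finsetSum _ fun i _ => integrable_finsetSum _ fun j _ => (hterm _).const_mul _]
    push_cast
    rw [Finset.mul_sum]
    refine Finset.sum_congr rfl fun i _ => ?_
    rw [integral_finsetSum _ fun j _ => (hterm _).const_mul _, Finset.mul_sum]
    refine Finset.sum_congr rfl fun j _ => ?_
    rw [integral_const_mul, E3_ft]
    ring
  have hvn : ∀ ξ : E3, ξ ≠ 0 → 0 < wv ‖ξ‖ := fun ξ h => wv_pos _ (norm_pos_iff.2 h)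
  have hae : ∀ᵐ ξ : E3, ξ ≠ 0 := by simp [ae_iff]
  have hnn : 0 ≤ᵐ[volume] fun ξ : E3 => wv ‖ξ‖ * Complex.normSq (S ξ) := by
    filter_upwards [hae] with ξ h using mul_nonneg (hvn ξ h).le (Complex.normSq_nonneg _)
  have h0 : 0 < ∫ ξ : E3, wv ‖ξ‖ * Complex.normSq (S ξ) := by
    refine lt_of_le_of_ne (integral_nonneg_of_ae hnn) fun h => hc ?_
    have hz := (integral_eq_zero_iff_of_nonneg_ae hnn hInteg).1 h.symm
    have hS0 : S =ᵐ[volume] fun _ => 0 := by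
      filter_upwards [hz, hae] with ξ h1 h2
      have : wv ‖ξ‖ * Complex.normSq (S ξ) = 0 := h1
      exact Complex.normSq_eq_zero.1 ((mul_eq_zero.1 this).resolve_left (hvn ξ h2).ne')
    have hSc : Continuous S := by rw [hS]; fun_prop
    have := (hSc.ae_eq_iff_eq volume continuous_const).1 hS0
    exact exp_indep q hq c fun ξ => congrFun this ξ
  rw [hval] at h0
  have hpi : 0 < 4 * Real.pi ^ 2 := by have := Real.pi_pos; positivity
  exact pos_of_mul_pos_right h0 hpi.le

lemma exists_embed (d : ℕ) (hd : d ∈ ({1, 2, 3} : Set ℕ)) :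
    ∃ J : EuclideanSpace ℝ (Fin d) → E3, ∀ x y, ‖J x - J y‖ = ‖x - y‖ := by
  rcases hd with rfl | rfl | rfl
  · refine ⟨fun x => WithLp.toLp 2 (x 0, 0), fun x y => ?_⟩
    rw [← WithLp.toLp_sub, E3_norm, EuclideanSpace.norm_eq]
    simp
  · refine ⟨fun x => WithLp.toLp 2 (x 0, (x 1 : ℂ)), fun x y => ?_⟩
    rw [← WithLp.toLp_sub, E3_norm, EuclideanSpace.norm_eq]
    simp [Fin.sum_univ_succ, ← Complex.ofReal_sub]
  · refine ⟨fun x => WithLp.toLp 2 (x 0, ⟨x 1, x 2⟩), fun x y => ?_⟩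
    rw [← WithLp.toLp_sub, E3_norm, EuclideanSpace.norm_eq]
    simp [Fin.sum_univ_succ, ← Complex.normSq_eq_norm_sq, Complex.normSq_apply]
    congr 1
    ring

end

/-- Wendland's theorem (special case): for `d ∈ {1,2,3}` the Gram matrix of the C²
Wendland function at pairwise distinct nodes in `ℝ^d` is symmetric and positive
definite. -/
theorem wendland_gram_posDef (d N : ℕ) (hd : d ∈ ({1, 2, 3} : Set ℕ))
    (q : Fin N → EuclideanSpace ℝ (Fin d)) (hq : Function.Injective q)
    (B : Matrix (Fin N) (Fin N) ℝ) (hB : ∀ i j, B i j = wendlandC2 ‖q i - q j‖) :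
    B.IsSymm ∧ B.PosDef := by
  obtain ⟨J, hJ⟩ := exists_embed d hd
  have hsymm : B.IsSymm := by
    ext i j
    rw [Matrix.transpose_apply, hB, hB, norm_sub_rev]
  refine ⟨hsymm, ?_⟩
  have hinj : Function.Injective (fun i => J (q i)) := by
    intro i j h
    have h1 : J (q i) = J (q j) := h
    have h2 := hJ (q i) (q j)
    rw [h1, sub_self, norm_zero] at h2
    exact hq (sub_eq_zero.1 (norm_eq_zero.1 h2.symm))
  refine Matrix.PosDef.of_dotProduct_mulVec_pos ?_ ?_
  · rw [Matrix.IsHermitian, Matrix.conjTranspose_eq_transpose_of_trivial]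
    exact hsymm
  · intro c hc
    have := quad_pos (fun i => J (q i)) hinj c hc
    convert! this using 1
    simp only [dotProduct, Matrix.mulVec, Finset.mul_sum, hB, hJ, Pi.star_apply, star_trivial]
    refine Finset.sum_congr rfl fun i _ => Finset.sum_congr rfl fun j _ => ?_
    ring
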